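/- arXiv:2502.20595 — 4 statements merged into one kernel-verified Lean document; each statement's English description precedes it below -/
import Mathlib

section
/- The set of canonical basis elements z^{α₁} z̄^{β₁} ∂^{α₂} ∂̄^{β₂} of the Weyl algebra A₂ whose parameters satisfy α₁ + β₂ = β₁ + α₂ is a ℂ-vector-space basis of 𝔑₂, the set of all operators in A₂ that commute with rotations: this family is linearly independent over ℂ and its span equals 𝔑₂. -/
open MvPolynomial

noncomputable section

/-- The polynomial ring ℂ[z, z̄]; `X 0` is `z` and `X 1` is `z̄`. -/
abbrev P2 : Type := MvPolynomial (Fin 2) ℂ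

/-- Multiplication by `z`. -/
def Mz : Module.End ℂ P2 := LinearMap.mulLeft ℂ (X 0 : P2)
/-- Multiplication by `z̄`. -/
def Mzbar : Module.End ℂ P2 := LinearMap.mulLeft ℂ (X 1 : P2)
/-- Formal `∂/∂z`. -/
def Dz : Module.End ℂ P2 := (pderiv (0 : Fin 2)).toLinearMap
/-- Formal `∂/∂z̄`. -/
def Dzbar : Module.End ℂ P2 := (pderiv (1 : Fin 2)).toLinearMap

/-- Rotation operator `R_θ : p(z, z̄) ↦ p(e^{iθ} z, e^{-iθ} z̄)`. -/
def rot (θ : ℝ) : Module.End ℂ P2 :=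
  (aeval (fun i : Fin 2 => if i = 0 then (Complex.exp (θ * Complex.I)) • (X 0 : P2)
    else (Complex.exp (-(θ * Complex.I))) • (X 1 : P2))).toLinearMap

/-- `D` commutes with rotations: `D ∘ R_θ = R_θ ∘ D` for all `θ ∈ [0, 2π)`. -/
def CommutesWithRotations (D : Module.End ℂ P2) : Prop :=
  ∀ θ : ℝ, 0 ≤ θ → θ < 2 * Real.pi → D * rot θ = rot θ * D

/-- The second Weyl algebra `A₂`, as a subalgebra of `End ℂ (ℂ[z, z̄])`. -/
def WeylA2 : Subalgebra ℂ (Module.End ℂ P2) :=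
  Algebra.adjoin ℂ {Mz, Mzbar, Dz, Dzbar}

/-- Canonical basis element `z^{a1} z̄^{b1} ∂^{a2} ∂̄^{b2}` of `A₂`. -/
def canB (a1 b1 a2 b2 : ℕ) : Module.End ℂ P2 :=
  Mz ^ a1 * Mzbar ^ b1 * Dz ^ a2 * Dzbar ^ b2

/-- The canonical family of `A₂`, indexed by `(α₁, β₁, α₂, β₂)`. -/
def canFamily (t : ℕ × ℕ × ℕ × ℕ) : Module.End ℂ P2 :=
  canB t.1 t.2.1 t.2.2.1 t.2.2.2

/-! ### Commutation relations -/

lemma commute_Mz_Mzbar : Commute Mz Mzbar := by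
  refine LinearMap.ext fun p => ?_
  simp [Mz, Mzbar, mul_left_comm]

lemma commute_Dz_Dzbar : Commute Dz Dzbar := by
  refine LinearMap.ext fun p => ?_
  have h : ⁅(pderiv 0 : Derivation ℂ P2 P2), (pderiv 1 : Derivation ℂ P2 P2)⁆ = 0 := by
    refine MvPolynomial.derivation_ext fun i => ?_
    rw [Derivation.commutator_apply]
    fin_cases i <;> simp [pderiv_X]
  have := DFunLike.congr_fun h p
  rw [Derivation.commutator_apply] at this
  simpa [Dz, Dzbar, sub_eq_zero] using this

lemma commute_Dz_Mzbar : Commute Dz Mzbar := by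
  refine LinearMap.ext fun p => ?_
  simp [Dz, Mzbar, pderiv_X]

lemma commute_Dzbar_Mz : Commute Dzbar Mz := by
  refine LinearMap.ext fun p => ?_
  simp [Dzbar, Mz, pderiv_X]

lemma Dz_mul_Mz : Dz * Mz = Mz * Dz + 1 := by
  refine LinearMap.ext fun p => ?_
  simp [Dz, Mz, pderiv_X]

lemma Dzbar_mul_Mzbar : Dzbar * Mzbar = Mzbar * Dzbar + 1 := by
  refine LinearMap.ext fun p => ?_
  simp [Dzbar, Mzbar, pderiv_X]

/-- In a ring where `[d, m] = 1`, one has `[d, mⁿ] = n mⁿ⁻¹`. -/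
lemma mul_pow_of_commutator_eq_one {R : Type*} [Ring R] {d m : R} (h : d * m = m * d + 1)
    (n : ℕ) : d * m ^ n = m ^ n * d + n • m ^ (n - 1) := by
  induction n with
  | zero => simp
  | succ n ih =>
    have hn : (n • m ^ (n - 1)) * m = n • m ^ n := by
      rcases n with _ | n
      · simp
      · simp [pow_succ, mul_assoc]
    rw [pow_succ, ← mul_assoc, ih, add_mul, hn, mul_assoc, h, Nat.add_sub_cancel, succ_nsmul]
    noncomm_ring

/-! ### The canonical family spans `A₂` -/

lemma Mz_mul_canB (a b c d : ℕ) : Mz * canB a b c d = canB (a + 1) b c d := by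
  simp only [canB, pow_succ', mul_assoc]

lemma Mzbar_mul_canB (a b c d : ℕ) : Mzbar * canB a b c d = canB a (b + 1) c d := by
  simp only [canB, pow_succ' Mzbar b, ← mul_assoc]
  rw [(commute_Mz_Mzbar.pow_left a).eq]

lemma Dz_mul_canB (a b c d : ℕ) :
    Dz * canB a b c d = canB a b (c + 1) d + a • canB (a - 1) b c d := by
  have h := (commute_Dz_Mzbar.pow_right b).eq
  simp only [canB, ← mul_assoc]
  rw [mul_pow_of_commutator_eq_one Dz_mul_Mz, add_mul, add_mul, add_mul, mul_assoc (Mz ^ a) Dz, h,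
    pow_succ' Dz c]
  simp only [mul_assoc, smul_mul_assoc]

lemma Dzbar_mul_canB (a b c d : ℕ) :
    Dzbar * canB a b c d = canB a b c (d + 1) + b • canB a (b - 1) c d := by
  have h := (commute_Dz_Dzbar.pow_left c).eq
  simp only [canB, ← mul_assoc]
  rw [(commute_Dzbar_Mz.pow_right a).eq, mul_assoc (Mz ^ a) Dzbar,
    mul_pow_of_commutator_eq_one Dzbar_mul_Mzbar, pow_succ' Dzbar d, ← mul_assoc _ Dzbar,
    mul_assoc _ (Dz ^ c) Dzbar, h]
  simp only [mul_assoc, smul_mul_assoc, mul_add, add_mul, mul_smul_comm]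

lemma canB_mem_WeylA2 (a b c d : ℕ) : canB a b c d ∈ WeylA2 := by
  have h (x) (hx : x ∈ ({Mz, Mzbar, Dz, Dzbar} : Set (Module.End ℂ P2))) : x ∈ WeylA2 :=
    Algebra.subset_adjoin hx
  exact mul_mem (mul_mem (mul_mem (pow_mem (h _ (by simp)) _) (pow_mem (h _ (by simp)) _))
    (pow_mem (h _ (by simp)) _)) (pow_mem (h _ (by simp)) _)

lemma mul_mem_span_canFamily {x y : Module.End ℂ P2}
    (hx : x ∈ ({Mz, Mzbar, Dz, Dzbar} : Set (Module.End ℂ P2)))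
    (hy : y ∈ Submodule.span ℂ (Set.range canFamily)) :
    x * y ∈ Submodule.span ℂ (Set.range canFamily) := by
  have hc (a b c d : ℕ) : canB a b c d ∈ Submodule.span ℂ (Set.range canFamily) :=
    Submodule.subset_span ⟨(a, b, c, d), rfl⟩
  induction hy using Submodule.span_induction with
  | mem y hy =>
    obtain ⟨⟨a, b, c, d⟩, rfl⟩ := hy
    simp only [canFamily]
    rcases hx with rfl | rfl | rfl | rfl
    · rw [Mz_mul_canB]
      exact hc _ _ _ _
    · rw [Mzbar_mul_canB]
      exact hc _ _ _ _
    · rw [Dz_mul_canB]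
      exact add_mem (hc _ _ _ _) (nsmul_mem (hc _ _ _ _) _)
    · rw [Dzbar_mul_canB]
      exact add_mem (hc _ _ _ _) (nsmul_mem (hc _ _ _ _) _)
  | zero => simp
  | add y z _ _ hy hz =>
    rw [mul_add]
    exact add_mem hy hz
  | smul r y _ hy =>
    rw [mul_smul_comm]
    exact Submodule.smul_mem _ r hy

lemma WeylA2_le_span_canFamily :
    Subalgebra.toSubmodule WeylA2 ≤ Submodule.span ℂ (Set.range canFamily) := by
  rw [WeylA2, Algebra.adjoin_eq_span, Submodule.span_le]
  intro x hx
  induction hx using Submonoid.closure_induction_left with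
  | one => exact Submodule.subset_span ⟨(0, 0, 0, 0), by simp [canFamily, canB]⟩
  | mul_left x hx y _ hy => exact mul_mem_span_canFamily hx hy

/-! ### Linear independence -/

lemma pderiv_pow_monomial (i : Fin 2) (n : ℕ) (s : Fin 2 →₀ ℕ) (r : ℂ) :
    ((pderiv i).toLinearMap ^ n : Module.End ℂ P2) (monomial s r) =
      monomial (s - Finsupp.single i n) (r * (s i).descFactorial n) := by
  induction n with
  | zero => simp
  | succ n ih =>
    rw [pow_succ', Module.End.mul_apply, ih, Derivation.coeFn_coe, pderiv_monomial,
      Nat.descFactorial_succ, tsub_tsub, ← Finsupp.single_add]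
    simp only [Finsupp.coe_tsub, Pi.sub_apply, Finsupp.single_eq_same, Nat.cast_mul]
    congr 1
    ring

lemma mulLeft_X_pow_monomial (i : Fin 2) (n : ℕ) (s : Fin 2 →₀ ℕ) (r : ℂ) :
    (LinearMap.mulLeft ℂ (X i : P2) ^ n : Module.End ℂ P2) (monomial s r) =
      monomial (Finsupp.single i n + s) r := by
  rw [LinearMap.pow_mulLeft, LinearMap.mulLeft_apply, X_pow_eq_monomial, monomial_mul, one_mul]

lemma canB_monomial (a b c d : ℕ) (s : Fin 2 →₀ ℕ) (r : ℂ) :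
    canB a b c d (monomial s r) =
      monomial (Finsupp.single 0 a + (Finsupp.single 1 b +
          (s - Finsupp.single 1 d - Finsupp.single 0 c)))
        (r * (s 1).descFactorial d * (s 0).descFactorial c) := by
  simp only [canB, Mz, Mzbar, Dz, Dzbar, Module.End.mul_apply, pderiv_pow_monomial,
    mulLeft_X_pow_monomial]
  simp

lemma canB_monomial_of_le {a b c d c' d' : ℕ} (h : c + d ≤ c' + d') :
    canB a b c' d' (monomial (Finsupp.single 0 c + Finsupp.single 1 d) 1) =
      if c' = c ∧ d' = d then
        monomial (Finsupp.single 0 a + Finsupp.single 1 b) (d.factorial * c.factorial : ℂ)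
      else 0 := by
  rw [canB_monomial]
  split_ifs with h'
  · obtain ⟨rfl, rfl⟩ := h'
    simp [Nat.descFactorial_self]
  · have : c < c' ∨ d < d' := by omega
    rcases this with h | h <;> simp [Nat.descFactorial_of_lt h]

lemma linearIndependent_canFamily : LinearIndependent ℂ canFamily := by
  rw [linearIndependent_iff']
  intro s g hg
  suffices H : ∀ n a b c d, c + d = n → (a, b, c, d) ∈ s → g (a, b, c, d) = 0 from
    fun ⟨a, b, c, d⟩ ht => H _ a b c d rfl ht
  intro n
  induction n using Nat.strong_induction_on with
  | _ n ih =>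
  rintro a b c d rfl hs
  have h := congrArg (coeff (Finsupp.single 0 a + Finsupp.single 1 b))
    (LinearMap.congr_fun hg (monomial (Finsupp.single 0 c + Finsupp.single 1 d) 1))
  rw [LinearMap.sum_apply, coeff_sum, Finset.sum_eq_single_of_mem _ hs] at h
  · simpa [canFamily, canB_monomial_of_le, Nat.factorial_ne_zero] using h
  · rintro ⟨a', b', c', d'⟩ ht hne
    rcases lt_or_ge (c' + d') (c + d) with hlt | hle
    · simp [ih _ hlt a' b' c' d' rfl ht]
    · simp only [canFamily, LinearMap.smul_apply, coeff_smul, canB_monomial_of_le hle]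
      split_ifs with hcd
      · obtain ⟨rfl, rfl⟩ := hcd
        rw [coeff_monomial, if_neg, smul_zero]
        intro heq
        have h0 := DFunLike.congr_fun heq 0
        have h1 := DFunLike.congr_fun heq 1
        simp at h0 h1
        exact hne (by rw [h0, h1])
      · simp

/-! ### Weights under rotation -/

lemma rot_monomial (θ : ℝ) (s : Fin 2 →₀ ℕ) (r : ℂ) :
    rot θ (monomial s r) =
      monomial s (r * Complex.exp (((s 0 : ℂ) - s 1) * (θ * Complex.I))) := by
  have h : Complex.exp (((s 0 : ℂ) - s 1) * (θ * Complex.I)) =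
      Complex.exp (θ * Complex.I) ^ s 0 * Complex.exp (-(θ * Complex.I)) ^ s 1 := by
    rw [← Complex.exp_nat_mul, ← Complex.exp_nat_mul, ← Complex.exp_add]
    ring_nf
  rw [h, rot, AlgHom.toLinearMap_apply, aeval_monomial,
    Finsupp.prod_fintype _ _ (fun _ => pow_zero _), Fin.prod_univ_two, monomial_eq,
    Finsupp.prod_fintype _ _ (fun _ => pow_zero _), Fin.prod_univ_two]
  simp only [MvPolynomial.algebraMap_eq, if_true, one_ne_zero, if_false, smul_eq_C_mul,
    map_mul, map_pow]
  ring

lemma rot_mul_rot_neg (θ : ℝ) : rot θ * rot (-θ) = 1 := by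
  refine MvPolynomial.linearMap_ext fun s => LinearMap.ext fun r => ?_
  simp only [LinearMap.comp_apply, Module.End.mul_apply, rot_monomial, Module.End.one_apply,
    mul_assoc, ← Complex.exp_add]
  simp

/-- `D` has weight `k` for the conjugation action of the rotation by `θ`. -/
def HasRotWeight (θ : ℝ) (k : ℤ) (D : Module.End ℂ P2) : Prop :=
  rot θ * D = Complex.exp (k * (θ * Complex.I)) • (D * rot θ)

namespace HasRotWeight

variable {θ : ℝ} {k l : ℤ} {D E : Module.End ℂ P2}

lemma mul (hD : HasRotWeight θ k D) (hE : HasRotWeight θ l E) :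
    HasRotWeight θ (k + l) (D * E) := by
  unfold HasRotWeight at *
  rw [← mul_assoc, hD, smul_mul_assoc, mul_assoc, hE, mul_smul_comm, smul_smul, ← Complex.exp_add,
    mul_assoc]
  push_cast
  rw [add_mul]

lemma pow (hD : HasRotWeight θ k D) (n : ℕ) : HasRotWeight θ (n * k) (D ^ n) := by
  induction n with
  | zero => simp [HasRotWeight]
  | succ n ih =>
    rw [pow_succ]
    convert ih.mul hD using 1
    push_cast
    ring

end HasRotWeight

lemma hasRotWeight_Mz (θ : ℝ) : HasRotWeight θ 1 Mz := by
  refine LinearMap.ext fun p => ?_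
  simp [Mz, rot]

lemma hasRotWeight_Mzbar (θ : ℝ) : HasRotWeight θ (-1) Mzbar := by
  refine LinearMap.ext fun p => ?_
  simp [Mzbar, rot]

lemma hasRotWeight_Dz (θ : ℝ) : HasRotWeight θ (-1) Dz := by
  refine MvPolynomial.linearMap_ext fun s => LinearMap.ext fun r => ?_
  simp only [Dz, LinearMap.comp_apply, Module.End.mul_apply, LinearMap.smul_apply,
    Derivation.coeFn_coe, rot_monomial, pderiv_monomial, smul_monomial]
  congr 1
  rcases h : s 0 with _ | n
  · simp
  · simp only [Finsupp.coe_tsub, Pi.sub_apply, h, Finsupp.single_eq_same, smul_eq_mul]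
    rw [mul_right_comm r (Complex.exp _), mul_left_comm (Complex.exp _), ← Complex.exp_add]
    congr 2
    simp
    ring

lemma hasRotWeight_Dzbar (θ : ℝ) : HasRotWeight θ 1 Dzbar := by
  refine MvPolynomial.linearMap_ext fun s => LinearMap.ext fun r => ?_
  simp only [Dzbar, LinearMap.comp_apply, Module.End.mul_apply, LinearMap.smul_apply,
    Derivation.coeFn_coe, rot_monomial, pderiv_monomial, smul_monomial]
  congr 1
  rcases h : s 1 with _ | n
  · simp
  · simp only [Finsupp.coe_tsub, Pi.sub_apply, h, Finsupp.single_eq_same, smul_eq_mul]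
    rw [mul_right_comm r (Complex.exp _), mul_left_comm (Complex.exp _), ← Complex.exp_add]
    congr 2
    simp
    ring

lemma hasRotWeight_canFamily (θ : ℝ) (t : ℕ × ℕ × ℕ × ℕ) :
    HasRotWeight θ (t.1 + t.2.2.2 - (t.2.1 + t.2.2.1)) (canFamily t) := by
  convert ((((hasRotWeight_Mz θ).pow t.1).mul ((hasRotWeight_Mzbar θ).pow t.2.1)).mul
    ((hasRotWeight_Dz θ).pow t.2.2.1)).mul ((hasRotWeight_Dzbar θ).pow t.2.2.2) using 1
  · ring
  · rfl

/-- The rotation by one radian distinguishes weight zero from all other weights. -/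
lemma exp_int_mul_I_eq_one_iff (k : ℤ) :
    Complex.exp (k * ((1 : ℝ) * Complex.I)) = 1 ↔ k = 0 := by
  refine ⟨fun h => ?_, fun h => by simp [h]⟩
  obtain ⟨n, hn⟩ := Complex.exp_eq_one_iff.1 h
  have hk : (k : ℝ) = n * (2 * Real.pi) := by
    have := congrArg Complex.im hn
    simpa using this
  by_contra hk0
  have hn0 : n ≠ 0 := by
    rintro rfl
    exact hk0 (by simpa using hk)
  refine irrational_pi ⟨k / (2 * n), ?_⟩
  push_cast
  rw [hk]
  field_simp

lemma CommutesWithRotations.mem_span {D : Module.End ℂ P2} (hD : CommutesWithRotations D)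
    (hW : D ∈ WeylA2) :
    D ∈ Submodule.span ℂ
      (canFamily '' {t : ℕ × ℕ × ℕ × ℕ | t.1 + t.2.2.2 = t.2.1 + t.2.2.1}) := by
  obtain ⟨g, rfl⟩ := (Finsupp.mem_span_range_iff_exists_finsupp).1 (WeylA2_le_span_canFamily hW)
  have hcomm := hD 1 zero_le_one (by linarith [Real.pi_gt_three])
  set e : ℕ × ℕ × ℕ × ℕ → ℂ := fun t =>
    Complex.exp (((t.1 + t.2.2.2 - (t.2.1 + t.2.2.1) : ℤ) : ℂ) * ((1 : ℝ) * Complex.I))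
  have hrot : (∑ t ∈ g.support, (g t * (1 - e t)) • canFamily t) * rot 1 = 0 := by
    rw [Finsupp.sum, Finset.sum_mul, Finset.mul_sum, ← sub_eq_zero,
      ← Finset.sum_sub_distrib] at hcomm
    rw [Finset.sum_mul, ← hcomm]
    refine Finset.sum_congr rfl fun t _ => ?_
    rw [mul_smul_comm, hasRotWeight_canFamily 1 t, smul_mul_assoc, smul_mul_assoc, smul_smul,
      ← sub_smul, mul_sub, mul_one]
  have hzero : ∑ t ∈ g.support, (g t * (1 - e t)) • canFamily t = 0 := by
    rw [← mul_one (∑ t ∈ g.support, _), ← rot_mul_rot_neg 1, ← mul_assoc, hrot, zero_mul]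
  refine Submodule.sum_mem _ fun t ht => Submodule.smul_mem _ _ (Submodule.subset_span ⟨t, ?_, rfl⟩)
  have h := linearIndependent_iff'.1 linearIndependent_canFamily _ _ hzero t ht
  have h1 := (mul_eq_zero.1 h).resolve_left (Finsupp.mem_support_iff.1 ht)
  have h2 := (exp_int_mul_I_eq_one_iff _).1 (sub_eq_zero.1 h1).symm
  simp only [Set.mem_ofPred_eq]
  omega

/-- the canonical basis elements with `α₁ + β₂ = β₁ + α₂` form a
ℂ-basis of the set `𝔑₂` of operators in `A₂` commuting with rotations:
they are linearly independent and their span equals `𝔑₂`. -/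
theorem canB_basis_of_rotationInvariant :
    LinearIndependent ℂ
      (fun t : {t : ℕ × ℕ × ℕ × ℕ // t.1 + t.2.2.2 = t.2.1 + t.2.2.1} =>
        canB t.1.1 t.1.2.1 t.1.2.2.1 t.1.2.2.2) ∧
    (Submodule.span ℂ
        (Set.range (fun t : {t : ℕ × ℕ × ℕ × ℕ // t.1 + t.2.2.2 = t.2.1 + t.2.2.1} =>
          canB t.1.1 t.1.2.1 t.1.2.2.1 t.1.2.2.2)) : Set (Module.End ℂ P2)) =
      {D : Module.End ℂ P2 | D ∈ WeylA2 ∧ CommutesWithRotations D} := by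
  refine ⟨linearIndependent_canFamily.comp _ Subtype.val_injective, Set.Subset.antisymm ?_ ?_⟩
  · intro D hD
    refine Submodule.span_induction (p := fun D _ => D ∈ WeylA2 ∧ CommutesWithRotations D)
      ?_ ⟨zero_mem _, fun θ _ _ => by simp⟩ ?_ ?_ hD
    · rintro _ ⟨⟨t, ht⟩, rfl⟩
      refine ⟨canB_mem_WeylA2 _ _ _ _, fun θ _ _ => ?_⟩
      have h := hasRotWeight_canFamily θ t
      have h0 : (t.1 + t.2.2.2 - (t.2.1 + t.2.2.1) : ℤ) = 0 := by omega
      rw [h0] at h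
      simpa [HasRotWeight, canFamily] using h.symm
    · rintro x y _ _ ⟨hx, hx'⟩ ⟨hy, hy'⟩
      exact ⟨add_mem hx hy, fun θ h₀ h₁ => by rw [add_mul, mul_add, hx' θ h₀ h₁, hy' θ h₀ h₁]⟩
    · rintro r x _ ⟨hx, hx'⟩
      exact ⟨Subalgebra.smul_mem _ hx r,
        fun θ h₀ h₁ => by rw [smul_mul_assoc, mul_smul_comm, hx' θ h₀ h₁]⟩
  · rintro D ⟨hW, hD⟩
    have h := hD.mem_span hW
    rw [Set.image_eq_range] at h
    exact h
end
end

section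
/- Let D be an operator in the Weyl algebra A₂ that commutes with rotations. Then for every m ∈ ℤ there exists an operator T_m in the first Weyl algebra A₁ (the ℂ-subalgebra of endomorphisms of ℂ[x] generated by multiplication by x and by d/dx) such that D(φ(|z|²) ξ_m(z)) = ξ_m(z) · (T_m φ)(|z|²) for every polynomial φ ∈ ℂ[x]. -/
open MvPolynomial

noncomputable section

/-- `ξ_m(z) = z^m` for `m ≥ 0`, and `ξ_m(z) = z̄^{|m|}` for `m < 0`. -/
def xi (m : ℤ) : P2 := if 0 ≤ m then (X 0 : P2) ^ m.toNat else (X 1 : P2) ^ m.natAbs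

/-- Evaluation of a one-variable polynomial `φ ∈ ℂ[x]` at `|z|² = z z̄`,
giving `φ(|z|²) ∈ ℂ[z, z̄]`. -/
def evalZZ : Polynomial ℂ →ₐ[ℂ] P2 := Polynomial.aeval (X 0 * X 1 : P2)

/-- Multiplication by `x` on ℂ[x]. -/
def Mx : Module.End ℂ (Polynomial ℂ) := LinearMap.mulLeft ℂ (Polynomial.X : Polynomial ℂ)

/-- The formal derivative `d/dx` on ℂ[x]. -/
def Dx : Module.End ℂ (Polynomial ℂ) := Polynomial.derivative

/-- The first Weyl algebra `A₁`, generated by `x` and `d/dx`. -/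
def WeylA1 : Subalgebra ℂ (Module.End ℂ (Polynomial ℂ)) :=
  Algebra.adjoin ℂ {Mx, Dx}

/-- The parametrization `φ ↦ ξ_m(z) φ(|z|²)` of the polynomials of weight `m`. -/
def xiMulEval (m : ℤ) : Polynomial ℂ →ₗ[ℂ] P2 :=
  LinearMap.mulLeft ℂ (xi m) ∘ₗ evalZZ.toLinearMap

lemma xiMulEval_apply (m : ℤ) (φ : Polynomial ℂ) : xiMulEval m φ = xi m * evalZZ φ := rfl

lemma xi_natCast (n : ℕ) : xi n = X 0 ^ n := by simp [xi]

lemma xi_neg_natCast (n : ℕ) : xi (-n) = X 1 ^ n := by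
  rcases n with _ | n
  · simp [xi]
  · rw [xi, if_neg (by omega), Int.natAbs_neg, Int.natAbs_natCast]

lemma evalZZ_X_mul (φ : Polynomial ℂ) : evalZZ (Polynomial.X * φ) = X 0 * X 1 * evalZZ φ := by
  simp [evalZZ]

lemma pderiv_zero_evalZZ (φ : Polynomial ℂ) :
    pderiv 0 (evalZZ φ) = X 1 * evalZZ (Polynomial.derivative φ) := by
  rw [evalZZ, Derivation.map_aeval]
  simp [mul_comm]

lemma pderiv_one_evalZZ (φ : Polynomial ℂ) :
    pderiv 1 (evalZZ φ) = X 0 * evalZZ (Polynomial.derivative φ) := by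
  rw [evalZZ, Derivation.map_aeval]
  simp [mul_comm]

lemma Mx_mem_WeylA1 : Mx ∈ WeylA1 := Algebra.subset_adjoin (by simp)

lemma Dx_mem_WeylA1 : Dx ∈ WeylA1 := Algebra.subset_adjoin (by simp)

lemma smul_one_add_Mx_mul_Dx_mem_WeylA1 (c : ℂ) : c • 1 + Mx * Dx ∈ WeylA1 :=
  add_mem (WeylA1.smul_mem (one_mem _) c) (mul_mem Mx_mem_WeylA1 Dx_mem_WeylA1)

lemma exists_Mz_comp_xiMulEval (m : ℤ) :
    ∃ T ∈ WeylA1, Mz ∘ₗ xiMulEval m = xiMulEval (m + 1) ∘ₗ T := by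
  rcases le_or_gt 0 m with hm | hm
  · lift m to ℕ using hm
    refine ⟨1, one_mem _, LinearMap.ext fun φ ↦ ?_⟩
    simp only [Mz, LinearMap.comp_apply, xiMulEval_apply, LinearMap.mulLeft_apply,
      Module.End.one_apply, ← Nat.cast_succ, xi_natCast, pow_succ']
    ring
  · obtain ⟨n, rfl⟩ : ∃ n : ℕ, m = -(n + 1 : ℕ) := ⟨(-m - 1).toNat, by omega⟩
    refine ⟨Mx, Mx_mem_WeylA1, LinearMap.ext fun φ ↦ ?_⟩
    rw [show -((n + 1 : ℕ) : ℤ) + 1 = -n by push_cast; ring]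
    simp only [Mz, Mx, LinearMap.comp_apply, xiMulEval_apply, LinearMap.mulLeft_apply,
      xi_neg_natCast, evalZZ_X_mul]
    ring

lemma exists_Mzbar_comp_xiMulEval (m : ℤ) :
    ∃ T ∈ WeylA1, Mzbar ∘ₗ xiMulEval m = xiMulEval (m - 1) ∘ₗ T := by
  rcases le_or_gt m 0 with hm | hm
  · obtain ⟨n, rfl⟩ : ∃ n : ℕ, m = -n := ⟨(-m).toNat, by omega⟩
    refine ⟨1, one_mem _, LinearMap.ext fun φ ↦ ?_⟩
    rw [show -(n : ℤ) - 1 = -(n + 1 : ℕ) by push_cast; ring]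
    simp only [Mzbar, LinearMap.comp_apply, xiMulEval_apply, LinearMap.mulLeft_apply,
      Module.End.one_apply, xi_neg_natCast]
    ring
  · obtain ⟨n, rfl⟩ : ∃ n : ℕ, m = (n + 1 : ℕ) := ⟨(m - 1).toNat, by omega⟩
    refine ⟨Mx, Mx_mem_WeylA1, LinearMap.ext fun φ ↦ ?_⟩
    rw [show ((n + 1 : ℕ) : ℤ) - 1 = n by push_cast; ring]
    simp only [Mzbar, Mx, LinearMap.comp_apply, xiMulEval_apply, LinearMap.mulLeft_apply,
      xi_natCast, evalZZ_X_mul]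
    ring

lemma exists_Dz_comp_xiMulEval (m : ℤ) :
    ∃ T ∈ WeylA1, Dz ∘ₗ xiMulEval m = xiMulEval (m - 1) ∘ₗ T := by
  rcases le_or_gt m 0 with hm | hm
  · obtain ⟨n, rfl⟩ : ∃ n : ℕ, m = -n := ⟨(-m).toNat, by omega⟩
    refine ⟨Dx, Dx_mem_WeylA1, LinearMap.ext fun φ ↦ ?_⟩
    rw [show -(n : ℤ) - 1 = -(n + 1 : ℕ) by push_cast; ring]
    simp only [LinearMap.comp_apply, xiMulEval_apply, xi_neg_natCast]
    simp [Dz, Dx, pderiv_zero_evalZZ, Derivation.leibniz_pow]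
    ring
  · obtain ⟨n, rfl⟩ : ∃ n : ℕ, m = (n + 1 : ℕ) := ⟨(m - 1).toNat, by omega⟩
    refine ⟨(n + 1 : ℂ) • 1 + Mx * Dx, smul_one_add_Mx_mul_Dx_mem_WeylA1 _,
      LinearMap.ext fun φ ↦ ?_⟩
    rw [show ((n + 1 : ℕ) : ℤ) - 1 = n by push_cast; ring]
    simp only [LinearMap.comp_apply, xiMulEval_apply, xi_natCast]
    simp [Dz, Dx, Mx, pderiv_zero_evalZZ, evalZZ_X_mul,
      Derivation.leibniz_pow, smul_eq_C_mul]
    ring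

lemma exists_Dzbar_comp_xiMulEval (m : ℤ) :
    ∃ T ∈ WeylA1, Dzbar ∘ₗ xiMulEval m = xiMulEval (m + 1) ∘ₗ T := by
  rcases le_or_gt 0 m with hm | hm
  · lift m to ℕ using hm
    refine ⟨Dx, Dx_mem_WeylA1, LinearMap.ext fun φ ↦ ?_⟩
    rw [← Nat.cast_succ]
    simp only [LinearMap.comp_apply, xiMulEval_apply, xi_natCast]
    simp [Dzbar, Dx, pderiv_one_evalZZ, Derivation.leibniz_pow]
    ring
  · obtain ⟨n, rfl⟩ : ∃ n : ℕ, m = -(n + 1 : ℕ) := ⟨(-m - 1).toNat, by omega⟩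
    refine ⟨(n + 1 : ℂ) • 1 + Mx * Dx, smul_one_add_Mx_mul_Dx_mem_WeylA1 _,
      LinearMap.ext fun φ ↦ ?_⟩
    rw [show -((n + 1 : ℕ) : ℤ) + 1 = -n by push_cast; ring]
    simp only [LinearMap.comp_apply, xiMulEval_apply, xi_neg_natCast]
    simp [Dzbar, Dx, Mx, pderiv_one_evalZZ, evalZZ_X_mul,
      Derivation.leibniz_pow, smul_eq_C_mul]
    ring

/-- The span of the maps `φ ↦ ξ_k(z) (T φ)(|z|²)` with `k ∈ ℤ` and `T ∈ A₁`. -/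
def xiMulEvalSpan : Submodule ℂ (Polynomial ℂ →ₗ[ℂ] P2) :=
  Submodule.span ℂ {F | ∃ k, ∃ T ∈ WeylA1, F = xiMulEval k ∘ₗ T}

lemma xiMulEval_mem_xiMulEvalSpan (m : ℤ) : xiMulEval m ∈ xiMulEvalSpan :=
  Submodule.subset_span ⟨m, 1, one_mem _, rfl⟩

lemma comp_mem_xiMulEvalSpan_of_forall {G : Module.End ℂ P2}
    (hG : ∀ m, ∃ k, ∃ T ∈ WeylA1, G ∘ₗ xiMulEval m = xiMulEval k ∘ₗ T)
    {F : Polynomial ℂ →ₗ[ℂ] P2} (hF : F ∈ xiMulEvalSpan) : G ∘ₗ F ∈ xiMulEvalSpan := by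
  induction hF using Submodule.span_induction with
  | mem F hF =>
    obtain ⟨m, S, hS, rfl⟩ := hF
    obtain ⟨k, T, hT, h⟩ := hG m
    exact Submodule.subset_span ⟨k, T * S, mul_mem hT hS, by
      rw [← LinearMap.comp_assoc, h, LinearMap.comp_assoc]; rfl⟩
  | zero => simp
  | add F F' _ _ h h' => rw [LinearMap.comp_add]; exact add_mem h h'
  | smul c F _ h => rw [LinearMap.comp_smul]; exact Submodule.smul_mem _ c h

lemma comp_mem_xiMulEvalSpan {D : Module.End ℂ P2} (hD : D ∈ WeylA2)
    {F : Polynomial ℂ →ₗ[ℂ] P2} (hF : F ∈ xiMulEvalSpan) : D ∘ₗ F ∈ xiMulEvalSpan := by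
  induction hD using Algebra.adjoin_induction generalizing F with
  | mem G hG =>
    refine comp_mem_xiMulEvalSpan_of_forall (fun m ↦ ?_) hF
    rcases hG with rfl | rfl | rfl | rfl
    exacts [⟨_, exists_Mz_comp_xiMulEval m⟩, ⟨_, exists_Mzbar_comp_xiMulEval m⟩,
      ⟨_, exists_Dz_comp_xiMulEval m⟩, ⟨_, exists_Dzbar_comp_xiMulEval m⟩]
  | algebraMap c => exact Submodule.smul_mem _ c hF
  | add D D' _ _ h h' => rw [LinearMap.add_comp]; exact add_mem (h hF) (h' hF)
  | mul D D' _ _ h h' => exact h (h' hF)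

/-- The grading of `ℂ[z, z̄]` by ℤ in which `z` has weight `1` and `z̄` has weight `-1`. -/
def rotWeight : Fin 2 → ℤ := ![1, -1]

lemma isWeightedHomogeneous_xi (m : ℤ) : IsWeightedHomogeneous rotWeight (xi m) m := by
  obtain ⟨n, rfl | rfl⟩ := m.eq_nat_or_neg
  · rw [xi_natCast]
    simpa [rotWeight] using (isWeightedHomogeneous_X ℂ rotWeight 0).pow n
  · rw [xi_neg_natCast]
    simpa [rotWeight] using (isWeightedHomogeneous_X ℂ rotWeight 1).pow n

lemma isWeightedHomogeneous_evalZZ (φ : Polynomial ℂ) :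
    IsWeightedHomogeneous rotWeight (evalZZ φ) 0 := by
  induction φ using Polynomial.induction_on' with
  | add p q hp hq => rw [map_add]; exact hp.add hq
  | monomial n c =>
    have h := (((isWeightedHomogeneous_X ℂ rotWeight 0).mul
      (isWeightedHomogeneous_X ℂ rotWeight 1)).pow n)
    have h' := (isWeightedHomogeneous_C rotWeight c).mul h
    simpa [evalZZ, Polynomial.aeval_monomial, rotWeight] using h'

lemma isWeightedHomogeneous_xiMulEval (m : ℤ) (φ : Polynomial ℂ) :
    IsWeightedHomogeneous rotWeight (xiMulEval m φ) m := by
  simpa [xiMulEval_apply] using (isWeightedHomogeneous_xi m).mul (isWeightedHomogeneous_evalZZ φ)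

lemma coeff_rot (θ : ℝ) (p : P2) (d : Fin 2 →₀ ℕ) :
    coeff d (rot θ p) =
      Complex.exp (Finsupp.weight rotWeight d * (θ * Complex.I)) * coeff d p := by
  induction p using MvPolynomial.induction_on' with
  | add p q hp hq => rw [map_add, coeff_add, coeff_add, hp, hq, mul_add]
  | monomial e c =>
    have h : rot θ (monomial e c) =
        Complex.exp (Finsupp.weight rotWeight e * (θ * Complex.I)) • monomial e c := by
      rw [monomial_eq, Finsupp.prod_fintype _ _ (by simp)]
      simp only [rot, Finsupp.weight_apply, Finsupp.sum_fintype, rotWeight, smul_pow,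
        ← Complex.exp_nat_mul, smul_smul, AlgHom.toLinearMap_apply, map_mul, algHom_C,
        Fin.prod_univ_two, map_pow, aeval_X, ↓reduceIte, one_ne_zero, zero_smul,
        implies_true, Fin.sum_univ_two, algebraMap_eq, smul_mul_assoc, mul_smul_comm,
        ← Complex.exp_add]
      congr 2
      simp
      ring
    rw [h, coeff_smul, coeff_monomial, smul_eq_mul]
    split_ifs with hed
    · rw [hed]
    · simp

lemma rot_eq_smul_of_isWeightedHomogeneous (θ : ℝ) {p : P2} {m : ℤ}
    (hp : IsWeightedHomogeneous rotWeight p m) :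
    rot θ p = Complex.exp (m * (θ * Complex.I)) • p := by
  ext d
  rw [coeff_rot, coeff_smul, smul_eq_mul]
  by_cases hd : coeff d p = 0
  · simp [hd]
  · rw [hp hd]

lemma exp_int_mul_I_injective :
    Function.Injective fun n : ℤ ↦ Complex.exp (n * ((1 : ℝ) * Complex.I)) := by
  intro n m h
  obtain ⟨k, hk⟩ := Complex.exp_eq_exp_iff_exists_int.mp h
  have hk' : (n : ℝ) = m + k * (2 * Real.pi) := by
    have := congrArg Complex.im hk
    simpa using this
  by_contra hnm
  have hk0 : (k : ℝ) ≠ 0 := by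
    intro h0
    rw [h0, zero_mul, add_zero] at hk'
    exact hnm (by exact_mod_cast hk')
  refine irrational_pi ⟨(n - m) / (2 * k), ?_⟩
  push_cast
  field_simp
  linarith

lemma isWeightedHomogeneous_of_rot_one_eq_smul {p : P2} {m : ℤ}
    (hp : rot 1 p = Complex.exp (m * ((1 : ℝ) * Complex.I)) • p) :
    IsWeightedHomogeneous rotWeight p m := by
  intro d hd
  have h := congrArg (coeff d) hp
  rw [coeff_rot, coeff_smul, smul_eq_mul] at h
  exact exp_int_mul_I_injective (mul_right_cancel₀ hd h)

lemma CommutesWithRotations.isWeightedHomogeneous {D : Module.End ℂ P2}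
    (hD : CommutesWithRotations D) {p : P2} {m : ℤ} (hp : IsWeightedHomogeneous rotWeight p m) :
    IsWeightedHomogeneous rotWeight (D p) m := by
  apply isWeightedHomogeneous_of_rot_one_eq_smul
  have h := LinearMap.congr_fun
    (hD 1 zero_le_one (by linarith [Real.pi_gt_three])) p
  rw [Module.End.mul_apply, Module.End.mul_apply,
    rot_eq_smul_of_isWeightedHomogeneous 1 hp, map_smul] at h
  exact h.symm

lemma exists_weightedHomogeneousComponent_comp_eq (m : ℤ) {F : Polynomial ℂ →ₗ[ℂ] P2}
    (hF : F ∈ xiMulEvalSpan) :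
    ∃ T ∈ WeylA1, weightedHomogeneousComponent rotWeight m ∘ₗ F = xiMulEval m ∘ₗ T := by
  induction hF using Submodule.span_induction with
  | mem F hF =>
    obtain ⟨k, T, hT, rfl⟩ := hF
    by_cases hk : k = m
    · subst hk
      refine ⟨T, hT, LinearMap.ext fun φ ↦ ?_⟩
      exact (isWeightedHomogeneous_xiMulEval k (T φ)).weightedHomogeneousComponent_same
    · refine ⟨0, zero_mem _, LinearMap.ext fun φ ↦ ?_⟩
      simpa using (isWeightedHomogeneous_xiMulEval k (T φ)).weightedHomogeneousComponent_ne m (Ne.symm hk)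
  | zero => exact ⟨0, zero_mem _, by simp⟩
  | add F F' _ _ h h' =>
    obtain ⟨T, hT, h⟩ := h
    obtain ⟨T', hT', h'⟩ := h'
    exact ⟨T + T', add_mem hT hT', by rw [LinearMap.comp_add, h, h', LinearMap.comp_add]⟩
  | smul c F _ h =>
    obtain ⟨T, hT, h⟩ := h
    exact ⟨c • T, WeylA1.smul_mem hT c, by rw [LinearMap.comp_smul, h, LinearMap.comp_smul]⟩

/-- if `D ∈ A₂` commutes with rotations then for every `m ∈ ℤ`
there is `T_m ∈ A₁` with `D(φ(|z|²) ξ_m) = ξ_m (T_m φ)(|z|²)` for all `φ`. -/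
theorem exists_Tm_of_commutesWithRotations (D : Module.End ℂ P2)
    (hD : D ∈ WeylA2) (hcomm : CommutesWithRotations D) :
    ∀ m : ℤ, ∃ T ∈ WeylA1, ∀ φ : Polynomial ℂ,
      D (evalZZ φ * xi m) = xi m * evalZZ (T φ) := by
  intro m
  obtain ⟨T, hT, h⟩ := exists_weightedHomogeneousComponent_comp_eq m
    (comp_mem_xiMulEvalSpan hD (xiMulEval_mem_xiMulEvalSpan m))
  refine ⟨T, hT, fun φ ↦ ?_⟩
  have hφ := hcomm.isWeightedHomogeneous (isWeightedHomogeneous_xiMulEval m φ)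
  rw [mul_comm, ← xiMulEval_apply, ← xiMulEval_apply,
    ← hφ.weightedHomogeneousComponent_same]
  exact LinearMap.congr_fun h φ
end
end

section
/- Let n ∈ ℕ be positive, let p ∈ ℂ[z, z̄] satisfy ∂ⁿ ∂̄ⁿ p = 0, and write p = ∑_{m ∈ ℤ} p_m(|z|²) ξ_m(z) with p_m ∈ ℂ[x] (all but finitely many zero). Then for each m ∈ ℤ there exist complex numbers k_{m,0}, …, k_{m,n−1} such that p_m(|z|²) ξ_m(z) = k_{m,0} O_0^{|m|,n−1}(|z|²) ξ_m(z) + … + k_{m,n−1} O_{n−1}^{|m|,n−1}(|z|²) ξ_m(z), equivalently p_m = ∑_{j=0}^{n−1} k_{m,j} O_j^{|m|,n−1} in ℂ[x]. -/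
open MvPolynomial

noncomputable section

/-- The hypergeometric polynomial
`o_l^{m,n}(x) = ∑_{j=0}^{n−l} ((−n+l)_j (m−n+l)_j / ((m+1)_j j!)) x^j`. -/
def opoly (m n l : ℕ) : Polynomial ℂ :=
  ∑ j ∈ Finset.range (n - l + 1),
    Polynomial.C ((ascPochhammer ℂ j).eval (-(n : ℂ) + l) *
        (ascPochhammer ℂ j).eval ((m : ℂ) - n + l) /
        ((ascPochhammer ℂ j).eval ((m : ℂ) + 1) * (j.factorial : ℂ))) *
      Polynomial.X ^ j

/-- `O_l^{m,n}(x) = (1 − x)^l o_l^{m,n}(x)`. -/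
def Opoly (m n l : ℕ) : Polynomial ℂ := (1 - Polynomial.X) ^ l * opoly m n l

section Field

variable {K : Type*} [Field K]

theorem ascPochhammer_eval_succ_left (n : ℕ) (x : K) :
    (ascPochhammer K (n + 1)).eval x = x * (ascPochhammer K n).eval (x + 1) := by
  simp [ascPochhammer_succ_left, Polynomial.eval_comp]

theorem ascPochhammer_eval_ne_zero {c : K} (hc : ∀ i : ℕ, c + i ≠ 0) (n : ℕ) :
    (ascPochhammer K n).eval c ≠ 0 := by
  induction n with
  | zero => simp
  | succ n ih => rw [ascPochhammer_succ_eval]; exact mul_ne_zero ih (hc n)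

/-- The Chu–Vandermonde identity. -/
theorem sum_choose_mul_ascPochhammer_div (k : ℕ) (b c : K) (hc : ∀ i : ℕ, c + i ≠ 0) :
    ∑ j ∈ Finset.range (k + 1), (k.choose j : K) *
        ((-1) ^ j * ((ascPochhammer K j).eval b / (ascPochhammer K j).eval c)) =
      (ascPochhammer K k).eval (c - b) / (ascPochhammer K k).eval c := by
  induction k generalizing b c with
  | zero => simp
  | succ k ih =>
    have hc₀ : c ≠ 0 := by simpa using hc 0
    have hc₁ : ∀ i : ℕ, c + 1 + i ≠ 0 := fun i => by
      have := hc (i + 1)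
      push_cast at this
      rwa [add_assoc, add_comm (1 : K)]
    have hshift : ∀ j : ℕ, (k.choose j : K) * ((-1) ^ (j + 1) *
        ((ascPochhammer K (j + 1)).eval b / (ascPochhammer K (j + 1)).eval c)) =
        -(b / c) * ((k.choose j : K) * ((-1) ^ j *
          ((ascPochhammer K j).eval (b + 1) / (ascPochhammer K j).eval (c + 1)))) := fun j => by
      rw [ascPochhammer_eval_succ_left, ascPochhammer_eval_succ_left, mul_div_mul_comm]
      ring
    rw [Finset.sum_choose_succ_mul (fun j _ => (-1) ^ j *
      ((ascPochhammer K j).eval b / (ascPochhammer K j).eval c)), ih b c hc]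
    simp only [hshift]
    rw [← Finset.mul_sum, ih (b + 1) (c + 1) hc₁, add_sub_add_right_eq_sub]
    have h₁ := ascPochhammer_eval_ne_zero hc k
    have h₂ := ascPochhammer_eval_ne_zero hc₁ k
    have h₃ : (ascPochhammer K k).eval c * (c + k) =
        c * (ascPochhammer K k).eval (c + 1) := by
      rw [← ascPochhammer_succ_eval, ascPochhammer_eval_succ_left]
    have h₄ : (ascPochhammer K k).eval (c + 1) = (ascPochhammer K k).eval c * (c + k) / c := by
      rw [h₃, mul_div_cancel_left₀ _ hc₀]
    have h₅ := hc k
    rw [ascPochhammer_succ_eval, ascPochhammer_succ_eval, h₄]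
    field_simp
    ring

/-- A triangular system with respect to powers of `1 - X` spans all polynomials of bounded
degree. -/
theorem mem_span_one_sub_X_pow_mul (n : ℕ) (o : ℕ → Polynomial K)
    (hdeg : ∀ l < n, (o l).degree < (n - l : ℕ)) (hone : ∀ l < n, (o l).eval 1 ≠ 0)
    (k : ℕ) (hk : k ≤ n) (q : Polynomial K) (hq : q.degree < k) :
    (1 - Polynomial.X) ^ (n - k) * q ∈
      Submodule.span K (Set.range fun j : Fin n => (1 - Polynomial.X) ^ (j : ℕ) * o j) := by
  induction k generalizing q with
  | zero =>
    have : q = 0 := by simpa using hq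
    simp [this]
  | succ k ih =>
    have hl : n - (k + 1) < n := by omega
    set l := n - (k + 1) with hl_def
    set a : K := q.eval 1 / (o l).eval 1
    have hroot : (q - a • o l).IsRoot 1 := by
      simp [Polynomial.IsRoot, a, hone l hl]
    obtain ⟨r, hr⟩ := Polynomial.dvd_iff_isRoot.2 hroot
    have hdl : (a • o l).degree < (k + 1 : ℕ) := by
      refine (Polynomial.degree_smul_le _ _).trans_lt ((hdeg l hl).trans_eq ?_)
      congr 1
      omega
    have hdr : (-r).degree < k := by
      have h := (Polynomial.degree_sub_le q (a • o l)).trans_lt (max_lt hq hdl)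
      rw [hr, Polynomial.degree_mul, Polynomial.degree_X_sub_C] at h
      rw [Polynomial.degree_neg]
      by_cases h0 : r = 0
      · simp [h0]
      · rw [Polynomial.degree_eq_natDegree h0] at h ⊢
        norm_cast at h ⊢
        omega
    have hsplit : (1 - Polynomial.X) ^ l * q =
        (1 - Polynomial.X) ^ (n - k) * (-r) + a • ((1 - Polynomial.X) ^ l * o l) := by
      have : n - k = l + 1 := by omega
      rw [this, sub_eq_iff_eq_add.1 hr, Polynomial.C_1, mul_add, mul_smul_comm]
      ring
    rw [hsplit]
    exact add_mem (ih (by omega) _ hdr)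
      (Submodule.smul_mem _ _ (Submodule.subset_span ⟨⟨l, hl⟩, rfl⟩))

end Field

theorem opoly_degree_lt (m n l : ℕ) : (opoly m n l).degree < (n - l + 1 : ℕ) := by
  refine (Polynomial.degree_sum_le _ _).trans_lt
    ((Finset.sup_lt_iff (WithBot.bot_lt_coe _)).2 fun j hj => ?_)
  refine (Polynomial.degree_C_mul_X_pow_le _ _).trans_lt ?_
  exact_mod_cast Finset.mem_range.1 hj

theorem ascPochhammer_eval_neg_natCast (k j : ℕ) :
    (ascPochhammer ℂ j).eval (-(k : ℂ)) = (-1) ^ j * (j.factorial * k.choose j) := by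
  rw [ascPochhammer_eval_neg_eq_descPochhammer, descPochhammer_eval_eq_descFactorial,
    Nat.descFactorial_eq_factorial_mul_choose, Nat.cast_mul]

theorem natCast_add_one_add_ne_zero (m i : ℕ) : (m : ℂ) + 1 + i ≠ 0 := by
  exact_mod_cast (by omega : m + 1 + i ≠ 0)

theorem opoly_eval_one_ne_zero (m n l : ℕ) (hl : l ≤ n) : (opoly m n l).eval 1 ≠ 0 := by
  obtain ⟨k, rfl⟩ := Nat.exists_eq_add_of_le hl
  have h := sum_choose_mul_ascPochhammer_div k ((m : ℂ) - k) (m + 1)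
    (natCast_add_one_add_ne_zero m)
  have heval : (opoly m (l + k) l).eval 1 =
      (ascPochhammer ℂ k).eval ((m : ℂ) + 1 - (m - k)) /
        (ascPochhammer ℂ k).eval ((m : ℂ) + 1) := by
    rw [← h, opoly, Polynomial.eval_finsetSum, Nat.add_sub_cancel_left]
    refine Finset.sum_congr rfl fun j _ => ?_
    have h₁ : -((l + k : ℕ) : ℂ) + l = -(k : ℂ) := by push_cast; ring
    have h₂ : (m : ℂ) - (l + k : ℕ) + l = m - k := by push_cast; ring
    have hf : (j.factorial : ℂ) ≠ 0 := by exact_mod_cast j.factorial_ne_zero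
    have hp := ascPochhammer_eval_ne_zero (natCast_add_one_add_ne_zero m) j
    rw [h₁, h₂, ascPochhammer_eval_neg_natCast]
    simp only [Polynomial.eval_mul, Polynomial.eval_C, Polynomial.eval_pow, Polynomial.eval_X,
      one_pow, mul_one]
    field_simp
  have hshift : (m : ℂ) + 1 - (m - k) = k + 1 := by ring
  rw [heval, hshift]
  exact div_ne_zero (ascPochhammer_eval_ne_zero (natCast_add_one_add_ne_zero k) k)
    (ascPochhammer_eval_ne_zero (natCast_add_one_add_ne_zero m) k)

theorem coeff_eq_zero_of_pderiv_pow {σ : Type*} (i : σ) (n : ℕ) (p : MvPolynomial σ ℂ)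
    (s : σ →₀ ℕ) (h : coeff s (((pderiv i).toLinearMap ^ n : Module.End ℂ _) p) = 0) :
    coeff (s + Finsupp.single i n) p = 0 := by
  induction n generalizing p with
  | zero => simpa using h
  | succ n ih =>
    rw [pow_succ, Module.End.mul_apply] at h
    have h' := ih _ h
    rw [Derivation.coeFn_coe, coeff_pderiv, mul_eq_zero] at h'
    rw [Finsupp.single_add, ← add_assoc]
    refine h'.resolve_right ?_
    exact Nat.cast_add_one_ne_zero _

/-- The exponent of `|z|^{2j} ξ_m(z)`. -/
def xiExponent (m : ℤ) (j : ℕ) : Fin 2 →₀ ℕ :=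
  Finsupp.single 0 (j + m.toNat) + Finsupp.single 1 (j + (-m).toNat)

theorem xiExponent_inj {m m' : ℤ} {j j' : ℕ} :
    xiExponent m j = xiExponent m' j' ↔ m = m' ∧ j = j' := by
  refine ⟨fun h => ?_, fun ⟨h, h'⟩ => by rw [h, h']⟩
  have h0 := DFunLike.congr_fun h 0
  have h1 := DFunLike.congr_fun h 1
  simp only [xiExponent, Finsupp.add_apply, Finsupp.single_apply] at h0 h1
  norm_num at h0 h1
  omega

theorem xi_eq_monomial (m : ℤ) :
    xi m = monomial (Finsupp.single 0 m.toNat + Finsupp.single 1 (-m).toNat) 1 := by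
  rw [← mul_one (1 : ℂ), ← monomial_mul, ← X_pow_eq_monomial, ← X_pow_eq_monomial, xi]
  split_ifs with h
  · rw [Int.toNat_of_nonpos (by omega : -m ≤ 0), pow_zero, mul_one]
  · rw [Int.toNat_of_nonpos (by omega : m ≤ 0), pow_zero, one_mul]
    congr 1
    omega

theorem evalZZ_monomial_mul_xi (m : ℤ) (j : ℕ) (a : ℂ) :
    evalZZ (Polynomial.monomial j a) * xi m = monomial (xiExponent m j) a := by
  rw [evalZZ, Polynomial.aeval_monomial, algebraMap_eq, mul_pow, X_pow_eq_monomial,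
    X_pow_eq_monomial, xi_eq_monomial, monomial_mul, mul_assoc, monomial_mul, C_mul_monomial]
  congr 1
  · rw [xiExponent, Finsupp.single_add, Finsupp.single_add, add_add_add_comm]
  · simp

theorem coeff_xiExponent_evalZZ_mul_xi (m m' : ℤ) (j : ℕ) (φ : Polynomial ℂ) :
    coeff (xiExponent m j) (evalZZ φ * xi m') = if m' = m then φ.coeff j else 0 := by
  induction φ using Polynomial.induction_on' with
  | add φ ψ hφ hψ => rw [map_add, add_mul, coeff_add, hφ, hψ]; split_ifs <;> simp
  | monomial i a =>
    rw [evalZZ_monomial_mul_xi, coeff_monomial, Polynomial.coeff_monomial]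
    simp only [xiExponent_inj]
    split_ifs <;> simp_all

theorem coeff_xiExponent_sum (f : ℤ →₀ Polynomial ℂ) (m : ℤ) (j : ℕ) :
    coeff (xiExponent m j) (f.sum fun m φ => evalZZ φ * xi m) = (f m).coeff j := by
  rw [Finsupp.sum, coeff_sum]
  simp only [coeff_xiExponent_evalZZ_mul_xi]
  by_cases hm : f m = 0 <;> simp [hm]

theorem degree_component_lt (n : ℕ) (p : P2) (hp : (Dz ^ n * Dzbar ^ n) p = 0)
    (f : ℤ →₀ Polynomial ℂ) (hrep : p = f.sum fun m φ => evalZZ φ * xi m) (m : ℤ) :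
    (f m).degree < n := by
  rw [Polynomial.degree_lt_iff_coeff_zero]
  intro j hj
  obtain ⟨i, rfl⟩ := Nat.exists_eq_add_of_le hj
  rw [← coeff_xiExponent_sum, ← hrep]
  have hexp : xiExponent m (n + i) =
      xiExponent m i + Finsupp.single 0 n + Finsupp.single 1 n := by
    simp only [xiExponent, Finsupp.single_add]
    abel
  rw [hexp]
  apply coeff_eq_zero_of_pderiv_pow
  apply coeff_eq_zero_of_pderiv_pow
  rw [Module.End.mul_apply, Dz, Dzbar] at hp
  rw [hp, coeff_zero]

/-- if `p` is polyharmonic of order `n > 0` and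
`p = ∑_m p_m(|z|²) ξ_m(z)`, then each coefficient `p_m` is a ℂ-linear
combination of `O_0^{|m|,n−1}, …, O_{n−1}^{|m|,n−1}`. -/
theorem component_in_Opoly_span (n : ℕ) (hn : 0 < n) (p : P2)
    (hp : (Dz ^ n * Dzbar ^ n) p = 0)
    (f : ℤ →₀ Polynomial ℂ)
    (hrep : p = f.sum fun m φ => evalZZ φ * xi m) :
    ∀ m : ℤ, ∃ k : Fin n → ℂ,
      f m = ∑ j : Fin n, k j • Opoly m.natAbs (n - 1) (j : ℕ) := by
  intro m
  have hmem := mem_span_one_sub_X_pow_mul n (opoly m.natAbs (n - 1))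
    (fun l hl => (opoly_degree_lt _ _ _).trans_eq (by congr 1; omega))
    (fun l hl => opoly_eval_one_ne_zero _ _ _ (by omega)) n le_rfl (f m)
    (degree_component_lt n p hp f hrep m)
  rw [Nat.sub_self, pow_zero, one_mul, Submodule.mem_span_range_iff_exists_fun] at hmem
  obtain ⟨k, hk⟩ := hmem
  exact ⟨k, hk.symm⟩
end
end

section
/- Let n ∈ ℕ be positive and let p ∈ ℂ[z, z̄] satisfy ∂ⁿ ∂̄ⁿ p = 0 (p is polyharmonic of order n). Then there exist polynomials w₀, w₁, …, w_{n−1} ∈ ℂ[z, z̄] with L_{n−1−j, n−1−j} w_j = 0 for each 0 ≤ j ≤ n−1, such that p(z, z̄) = w₀(z, z̄) + (1 − |z|²) w₁(z, z̄) + … + (1 − |z|²)^{n−1} w_{n−1}(z, z̄) (the cellular decomposition of p). -/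
open MvPolynomial

noncomputable section

/-- The generalized harmonic operator
`L_{γ₁,γ₂} p = (1−|z|²)∂∂̄p + γ₁ z ∂p + γ₂ z̄ ∂̄p − γ₁γ₂ p`. -/
def Lop (γ₁ γ₂ : ℂ) (p : P2) : P2 :=
  (1 - X 0 * X 1) * (Dz (Dzbar p)) + γ₁ • ((X 0 : P2) * Dz p) +
    γ₂ • ((X 1 : P2) * Dzbar p) - (γ₁ * γ₂) • p

lemma Dz_apply (p : P2) : Dz p = pderiv 0 p := rfl

lemma Dzbar_apply (p : P2) : Dzbar p = pderiv 1 p := rfl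

/-- The defining function `1 - |z|²` of the unit disc. -/
def discDefect : P2 := 1 - X 0 * X 1

/-- The Euler operator `z∂ + z̄∂̄`. -/
def euler : Module.End ℂ P2 :=
  LinearMap.mulLeft ℂ (X 0) * Dz + LinearMap.mulLeft ℂ (X 1) * Dzbar

lemma euler_apply (p : P2) : euler p = X 0 * Dz p + X 1 * Dzbar p := rfl

/-- The harmonic polynomials, the kernel of `∂∂̄`. -/
def harmonicSubmodule : Submodule ℂ P2 := LinearMap.ker (Dz * Dzbar)

lemma mem_harmonicSubmodule {p : P2} : p ∈ harmonicSubmodule ↔ Dz (Dzbar p) = 0 := Iff.rfl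

lemma Dz_mul (p q : P2) : Dz (p * q) = p * Dz q + q * Dz p := by
  simp [Dz_apply]

lemma Dzbar_mul (p q : P2) : Dzbar (p * q) = p * Dzbar q + q * Dzbar p := by
  simp [Dzbar_apply]

lemma Dz_X_zero : Dz (X 0) = 1 := by simp [Dz_apply]

lemma Dz_X_one : Dz (X 1) = 0 := by simp [Dz_apply, pderiv_X]

lemma Dzbar_X_zero : Dzbar (X 0) = 0 := by simp [Dzbar_apply, pderiv_X]

lemma Dzbar_X_one : Dzbar (X 1) = 1 := by simp [Dzbar_apply]

lemma Dzbar_Dz (p : P2) : Dzbar (Dz p) = Dz (Dzbar p) := by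
  have h : ⁅(pderiv 1 : Derivation ℂ P2 P2), (pderiv 0 : Derivation ℂ P2 P2)⁆ = 0 := by
    ext i
    fin_cases i <;> simp [Derivation.commutator_apply, pderiv_X]
  have := congrArg (fun D : Derivation ℂ P2 P2 => D p) h
  simpa [Dz_apply, Dzbar_apply, Derivation.commutator_apply, sub_eq_zero] using this

lemma Dz_discDefect : Dz discDefect = -X 1 := by
  simp [discDefect, Dz_apply, pderiv_X]

lemma Dzbar_discDefect : Dzbar discDefect = -X 0 := by
  simp [discDefect, Dzbar_apply, pderiv_X]

lemma Dz_discDefect_pow_succ (k : ℕ) :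
    Dz (discDefect ^ (k + 1)) = -((k : P2) + 1) * discDefect ^ k * X 1 := by
  have h := Dz_discDefect
  rw [Dz_apply] at h ⊢
  rw [Derivation.leibniz_pow, h]
  simp
  ring

lemma Dzbar_discDefect_pow_succ (k : ℕ) :
    Dzbar (discDefect ^ (k + 1)) = -((k : P2) + 1) * discDefect ^ k * X 0 := by
  have h := Dzbar_discDefect
  rw [Dzbar_apply] at h ⊢
  rw [Derivation.leibniz_pow, h]
  simp
  ring

lemma discDefect_mul_Dz_discDefect_pow (k : ℕ) :
    discDefect * Dz (discDefect ^ k) = -(k : P2) * discDefect ^ k * X 1 := by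
  cases k with
  | zero => simp [Dz_apply]
  | succ k =>
    rw [Dz_discDefect_pow_succ]
    push_cast
    ring

lemma euler_mem_harmonicSubmodule {h : P2} (hh : h ∈ harmonicSubmodule) :
    euler h ∈ harmonicSubmodule := by
  rw [mem_harmonicSubmodule] at hh ⊢
  have h₁ : Dz (Dzbar (Dzbar h)) = 0 := by rw [← Dzbar_Dz, hh, map_zero]
  simp [euler_apply, Dz_mul, Dzbar_mul, Dz_X_one, Dzbar_X_zero, Dzbar_X_one,
    Dzbar_Dz, hh, h₁]

lemma Lop_harmonic (γ : ℂ) {h : P2} (hh : h ∈ harmonicSubmodule) :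
    Lop γ γ h = γ • (euler h - γ • h) := by
  rw [mem_harmonicSubmodule] at hh
  simp only [Lop, hh, euler_apply, MvPolynomial.smul_eq_C_mul, map_mul]
  ring

lemma Lop_add (γ₁ γ₂ : ℂ) (p q : P2) : Lop γ₁ γ₂ (p + q) = Lop γ₁ γ₂ p + Lop γ₁ γ₂ q := by
  simp only [Lop, map_add, MvPolynomial.smul_eq_C_mul]
  ring

lemma Lop_discDefect_pow_succ_mul (γ : ℂ) (k : ℕ) {h : P2} (hh : h ∈ harmonicSubmodule) :
    Lop γ γ (discDefect ^ (k + 1) * h) =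
      discDefect ^ k * (((k + 1) * (k - 2 * γ) : ℂ) • h) -
      discDefect ^ (k + 1) *
        ((k + 1 - γ : ℂ) • (euler h + (k + 1 - γ : ℂ) • h)) := by
  rw [mem_harmonicSubmodule] at hh
  have hs : (1 - X 0 * X 1 : P2) = discDefect := rfl
  have ht : (X 0 * X 1 : P2) = 1 - discDefect := by simp [discDefect]
  have hk := discDefect_mul_Dz_discDefect_pow k
  have hc : Dz (-((k : P2) + 1)) = 0 := by
    rw [Dz_apply, map_neg, map_add]
    simp
  simp only [Lop, hs, euler_apply, MvPolynomial.smul_eq_C_mul, Dz_mul, Dzbar_mul, map_add, hh,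
    Dz_discDefect_pow_succ, Dzbar_discDefect_pow_succ, Dz_X_zero, hc, map_mul, map_sub, map_one,
    map_natCast, map_ofNat]
  linear_combination (-((k : P2) + 1) * X 0 * h) * hk +
    (discDefect ^ k * h * ((k : P2) + 1) * (k - 2 * C γ)) * ht

/-- The coefficients of the solution of `L_{γ,γ} w = 0` that agrees with `h` on `|z| = 1`,
expanded in powers of `1 - |z|²`. -/
def solCoeff (γ : ℂ) (h : P2) : ℕ → P2
  | 0 => h
  | k + 1 => (((k + 1) * (k - 2 * γ) : ℂ)⁻¹ * (k - γ)) •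
      (euler (solCoeff γ h k) + (k - γ : ℂ) • solCoeff γ h k)

lemma solCoeff_mem_harmonicSubmodule (γ : ℂ) {h : P2} (hh : h ∈ harmonicSubmodule) (k : ℕ) :
    solCoeff γ h k ∈ harmonicSubmodule := by
  induction k with
  | zero => exact hh
  | succ k ih =>
    exact harmonicSubmodule.smul_mem _ (harmonicSubmodule.add_mem
      (euler_mem_harmonicSubmodule ih) (harmonicSubmodule.smul_mem _ ih))

lemma Lop_sum_solCoeff (N : ℕ) {h : P2} (hh : h ∈ harmonicSubmodule) {M : ℕ} (hM : M ≤ N) :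
    Lop N N (∑ k ∈ Finset.range (M + 1), discDefect ^ k * solCoeff N h k) =
      -(discDefect ^ M * ((M - N : ℂ) •
        (euler (solCoeff N h M) + (M - N : ℂ) • solCoeff N h M))) := by
  induction M with
  | zero =>
    simp only [zero_add, Finset.sum_range_one, pow_zero, one_mul, solCoeff]
    rw [Lop_harmonic _ hh]
    simp only [MvPolynomial.smul_eq_C_mul, Nat.cast_zero, zero_sub, map_neg]
    ring
  | succ M ih =>
    have hne : ((M + 1) * (M - 2 * N) : ℂ) ≠ 0 := by
      refine mul_ne_zero (by exact_mod_cast M.succ_ne_zero) (sub_ne_zero.2 ?_)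
      exact_mod_cast (by omega : M ≠ 2 * N)
    rw [Finset.sum_range_succ, Lop_add, ih (by omega),
      Lop_discDefect_pow_succ_mul _ _ (solCoeff_mem_harmonicSubmodule _ hh _)]
    conv_lhs => enter [2, 1, 2, 2]; rw [solCoeff]
    rw [smul_smul, ← mul_assoc, mul_inv_cancel₀ hne, one_mul]
    push_cast
    ring

/-- The polynomials `∑_{k<n} (1 - |z|²)^k h_k` with harmonic coefficients `h_k`. -/
def almansi : ℕ → Submodule ℂ P2
  | 0 => ⊥
  | n + 1 => harmonicSubmodule ⊔ (almansi n).map (LinearMap.mulLeft ℂ discDefect)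

lemma mem_almansi_succ {n : ℕ} {p : P2} :
    p ∈ almansi (n + 1) ↔ ∃ h ∈ harmonicSubmodule, ∃ q ∈ almansi n, h + discDefect * q = p := by
  simp [almansi, Submodule.mem_sup]

lemma almansi_mono : Monotone almansi := by
  refine monotone_nat_of_le_succ fun n => ?_
  induction n with
  | zero => exact bot_le
  | succ n ih => exact sup_le_sup le_rfl (Submodule.map_mono ih)

lemma discDefect_mul_mem_almansi {n : ℕ} {p : P2} (hp : p ∈ almansi n) :
    discDefect * p ∈ almansi (n + 1) :=
  mem_almansi_succ.2 ⟨0, harmonicSubmodule.zero_mem, p, hp, zero_add _⟩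

lemma pow_mul_harmonic_mem_almansi {h : P2} (hh : h ∈ harmonicSubmodule) (k : ℕ) :
    (X 0 * X 1) ^ k * h ∈ almansi (k + 1) := by
  induction k with
  | zero => exact mem_almansi_succ.2 ⟨h, hh, 0, Submodule.zero_mem _, by simp⟩
  | succ k ih =>
    have e : (X 0 * X 1) ^ (k + 1) * h =
        (X 0 * X 1) ^ k * h - discDefect * ((X 0 * X 1) ^ k * h) := by
      simp only [discDefect]
      ring
    rw [e]
    exact Submodule.sub_mem _ (almansi_mono (Nat.le_succ _) ih) (discDefect_mul_mem_almansi ih)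

lemma sum_mem_almansi {f : ℕ → P2} (hf : ∀ k, f k ∈ harmonicSubmodule) (n : ℕ) :
    ∑ k ∈ Finset.range n, discDefect ^ k * f k ∈ almansi n := by
  induction n generalizing f with
  | zero => simp
  | succ n ih =>
    refine mem_almansi_succ.2 ⟨f 0, hf 0, _, ih fun k => hf (k + 1), ?_⟩
    rw [Finset.sum_range_succ', Finset.mul_sum, add_comm]
    simp [pow_succ', mul_assoc]

lemma X_zero_pow_mem_harmonicSubmodule (m : ℕ) : (X 0 : P2) ^ m ∈ harmonicSubmodule := by
  simp [mem_harmonicSubmodule, Dz_apply, Dzbar_apply, pderiv_X]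

lemma X_one_pow_mem_harmonicSubmodule (m : ℕ) : (X 1 : P2) ^ m ∈ harmonicSubmodule := by
  rw [mem_harmonicSubmodule, ← Dzbar_Dz]
  simp [Dz_apply, Dzbar_apply, pderiv_X]

lemma X_pow_mul_X_pow_mem_almansi {a b n : ℕ} (h : min a b < n) :
    (X 0 ^ a * X 1 ^ b : P2) ∈ almansi n := by
  refine almansi_mono (Nat.succ_le_of_lt h) ?_
  rcases le_total a b with hab | hab
  · obtain ⟨m, rfl⟩ := Nat.exists_eq_add_of_le hab
    rw [min_eq_left hab]
    convert pow_mul_harmonic_mem_almansi (X_one_pow_mem_harmonicSubmodule m) a using 1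
    ring
  · obtain ⟨m, rfl⟩ := Nat.exists_eq_add_of_le hab
    rw [min_eq_right hab]
    convert pow_mul_harmonic_mem_almansi (X_zero_pow_mem_harmonicSubmodule m) b using 1
    ring

lemma coeff_pderiv_pow_eq_zero_iff (i : Fin 2) (n : ℕ) (p : P2) (d : Fin 2 →₀ ℕ) :
    coeff d (((pderiv i).toLinearMap ^ n : Module.End ℂ P2) p) = 0 ↔
      coeff (d + Finsupp.single i n) p = 0 := by
  induction n generalizing p with
  | zero => simp
  | succ n ih =>
    have hne : ((d + Finsupp.single i n : Fin 2 →₀ ℕ) i + 1 : ℂ) ≠ 0 := by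
      exact_mod_cast Nat.succ_ne_zero ((d + Finsupp.single i n : Fin 2 →₀ ℕ) i)
    rw [pow_succ, Module.End.mul_apply, ih, Derivation.coeFn_coe, coeff_pderiv,
      mul_eq_zero, or_iff_left hne, add_assoc, ← Finsupp.single_add]

lemma mem_almansi_of_polyharmonic {n : ℕ} {p : P2} (hp : (Dz ^ n * Dzbar ^ n) p = 0) :
    p ∈ almansi n := by
  rw [p.as_sum]
  refine Submodule.sum_mem _ fun d hd => ?_
  have hlt : min (d 0) (d 1) < n := by
    by_contra! hle
    obtain ⟨h₀, h₁⟩ := le_min_iff.1 hle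
    refine mem_support_iff.1 hd ?_
    obtain ⟨e, rfl⟩ : ∃ e, d = e + Finsupp.single 0 n + Finsupp.single 1 n := by
      refine ⟨d - (Finsupp.single 0 n + Finsupp.single 1 n), ?_⟩
      ext i
      fin_cases i <;> simp <;> omega
    rw [← coeff_pderiv_pow_eq_zero_iff, ← coeff_pderiv_pow_eq_zero_iff]
    exact congrArg (coeff e) hp
  rw [monomial_eq, ← MvPolynomial.smul_eq_C_mul, Finsupp.prod_fintype _ _ (by simp),
    Fin.prod_univ_two]
  exact Submodule.smul_mem _ _ (X_pow_mul_X_pow_mem_almansi hlt)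

lemma exists_Lop_eq_zero_of_harmonic (N : ℕ) {h : P2} (hh : h ∈ harmonicSubmodule) :
    ∃ q ∈ almansi N, Lop N N (h + discDefect * q) = 0 := by
  refine ⟨∑ k ∈ Finset.range N, discDefect ^ k * solCoeff N h (k + 1),
    sum_mem_almansi (fun k => solCoeff_mem_harmonicSubmodule _ hh (k + 1)) N, ?_⟩
  have hL := Lop_sum_solCoeff N hh le_rfl
  rw [Finset.sum_range_succ', sub_self, zero_smul, mul_zero, neg_zero] at hL
  rw [← hL, Finset.mul_sum, add_comm]
  simp [pow_succ', mul_assoc, solCoeff]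

lemma exists_cellular_of_mem_almansi {n : ℕ} {p : P2} (hp : p ∈ almansi n) :
    ∃ w : Fin n → P2,
      (∀ j : Fin n,
        Lop ((n : ℂ) - 1 - (j : ℕ)) ((n : ℂ) - 1 - (j : ℕ)) (w j) = 0) ∧
      p = ∑ j : Fin n, discDefect ^ (j : ℕ) * w j := by
  induction n generalizing p with
  | zero => exact ⟨0, fun j => j.elim0, by simpa [almansi] using hp⟩
  | succ n ih =>
    obtain ⟨h, hh, q, hq, rfl⟩ := mem_almansi_succ.1 hp
    obtain ⟨r, hr, hL⟩ := exists_Lop_eq_zero_of_harmonic n hh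
    obtain ⟨w, hw, hsum⟩ := ih (Submodule.sub_mem _ hq hr)
    refine ⟨Fin.cons (h + discDefect * r) w, fun j => ?_, ?_⟩
    · cases j using Fin.cases with
      | zero => simpa using hL
      | succ j =>
        have e : ((n + 1 : ℕ) : ℂ) - 1 - (j.succ : ℕ) = n - 1 - (j : ℕ) := by
          push_cast [Fin.val_succ]
          ring
        rw [e]
        exact hw j
    · rw [Fin.sum_univ_succ]
      simp only [Fin.cons_zero, Fin.cons_succ, Fin.val_zero, Fin.val_succ, pow_succ', mul_assoc,
        ← Finset.mul_sum, ← hsum, pow_zero, one_mul]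
      ring

/-- cellular decomposition: a polynomial `p` with `∂ⁿ∂̄ⁿ p = 0`
(`n > 0`) can be written `p = w₀ + (1−|z|²) w₁ + … + (1−|z|²)^{n−1} w_{n−1}`
where `L_{n−1−j, n−1−j} w_j = 0` for each `j`. -/
theorem cellular_decomposition (n : ℕ) (hn : 0 < n) (p : P2)
    (hp : (Dz ^ n * Dzbar ^ n) p = 0) :
    ∃ w : Fin n → P2,
      (∀ j : Fin n,
        Lop ((n : ℂ) - 1 - (j : ℕ)) ((n : ℂ) - 1 - (j : ℕ)) (w j) = 0) ∧
      p = ∑ j : Fin n, (1 - X 0 * X 1 : P2) ^ (j : ℕ) * w j := by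
  exact exists_cellular_of_mem_almansi (mem_almansi_of_polyharmonic hp)
end
end
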